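/- arXiv:1512.04049 — 2 statements merged into one kernel-verified Lean document; each statement's English description precedes it below -/
import Mathlib

section
/- Let n ≥ 1, let J be the canonical 2n×2n symplectic matrix, let H be a symmetric real 2n×2n matrix, let h be a nonzero real number, and let B, C be real 2n×2n matrices satisfying (i) B + C = I and (ii) B·J = J·Cᵀ. If the matrix A₂ := I − h·J·H·C is invertible, then the linearized amplification matrix A := A₂⁻¹·(I + h·J·H·B) of the implicit scheme z_{k+1} = z_k + h·X_H(f(z_k, z_{k+1})) (where B, C are the partial derivative matrices of f) is symplectic, i.e. Aᵀ·J·A = J. (Linearized form of Proposition 1: the implicit scheme is a symplectic integrator.) -/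
open Matrix

/-- If `X` is invertible and `X * J * Xᵀ = Y * J * Yᵀ`, then `X⁻¹ * Y` is symplectic. -/
theorem inv_mul_mem_symplecticGroup {l R : Type*} [Fintype l] [DecidableEq l] [CommRing R]
    {X Y : Matrix (l ⊕ l) (l ⊕ l) R} (hX : IsUnit X)
    (hXY : X * Matrix.J l R * Xᵀ = Y * Matrix.J l R * Yᵀ) :
    X⁻¹ * Y ∈ Matrix.symplecticGroup l R := by
  have hdet : IsUnit X.det := (Matrix.isUnit_iff_isUnit_det X).1 hX
  rw [SymplecticGroup.mem_iff]
  calc X⁻¹ * Y * Matrix.J l R * (X⁻¹ * Y)ᵀ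
      = X⁻¹ * (Y * Matrix.J l R * Yᵀ) * X⁻¹ᵀ := by
        simp only [Matrix.transpose_mul, Matrix.mul_assoc]
    _ = (X⁻¹ * X) * Matrix.J l R * (X⁻¹ * X)ᵀ := by
        rw [← hXY]
        simp only [Matrix.transpose_mul, Matrix.mul_assoc]
    _ = Matrix.J l R := by
        rw [Matrix.nonsing_inv_mul X hdet, Matrix.transpose_one, Matrix.one_mul, Matrix.mul_one]

/-- Both factors of the amplification matrix transport `J` in the same way. -/
theorem implicit_scheme_congruence {m R : Type*} [Fintype m] [DecidableEq m] [CommRing R]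
    {J K B C : Matrix m m R} (hK : J * Kᵀ = -(K * J)) (hBC : B + C = 1)
    (hBJ : B * J = J * Cᵀ) :
    (1 - K * C) * J * (1 - K * C)ᵀ = (1 + K * B) * J * (1 + K * B)ᵀ := by
  obtain rfl : B = 1 - C := eq_sub_of_add_eq hBC
  have hC : J * (Cᵀ * Kᵀ) = -((1 - C) * (K * J)) := by
    rw [← Matrix.mul_assoc, ← hBJ, Matrix.mul_assoc, hK, Matrix.mul_neg]
  have hl : J * (1 - K * C)ᵀ = (1 + K - C * K) * J := by
    simp only [Matrix.transpose_sub, Matrix.transpose_mul, Matrix.transpose_one,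
      Matrix.mul_sub, hC]
    noncomm_ring
  have hr : J * (1 + K * (1 - C))ᵀ = (1 - C * K) * J := by
    simp only [Matrix.transpose_sub, Matrix.transpose_add, Matrix.transpose_mul,
      Matrix.transpose_one, Matrix.mul_sub, Matrix.sub_mul, Matrix.mul_add, Matrix.one_mul,
      hC, hK]
    noncomm_ring
  rw [Matrix.mul_assoc, Matrix.mul_assoc, hl, hr]
  noncomm_ring

/-- Linearized form of Proposition 1: under the conditions (i) `B + C = I` and
(ii) `B·J = J·Cᵀ`, the linearized amplification matrix
`A = (I − h·J·H·C)⁻¹ · (I + h·J·H·B)` of the implicit scheme is symplectic. -/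
theorem stmt_0 (n : ℕ) (hn : 1 ≤ n)
    (H B C : Matrix (Fin n ⊕ Fin n) (Fin n ⊕ Fin n) ℝ)
    (hH : Hᵀ = H) (h : ℝ) (hh : h ≠ 0)
    (hBC : B + C = 1)
    (hBJ : B * Matrix.J (Fin n) ℝ = Matrix.J (Fin n) ℝ * Cᵀ)
    (hA2 : IsUnit (1 - h • (Matrix.J (Fin n) ℝ * H * C))) :
    ((1 - h • (Matrix.J (Fin n) ℝ * H * C))⁻¹ *
        (1 + h • (Matrix.J (Fin n) ℝ * H * B)))ᵀ *
      Matrix.J (Fin n) ℝ *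
      ((1 - h • (Matrix.J (Fin n) ℝ * H * C))⁻¹ *
        (1 + h • (Matrix.J (Fin n) ℝ * H * B))) =
      Matrix.J (Fin n) ℝ := by
  rw [← SymplecticGroup.mem_iff']
  apply inv_mul_mem_symplecticGroup hA2
  have hK : Matrix.J (Fin n) ℝ * (h • (Matrix.J (Fin n) ℝ * H))ᵀ =
      -(h • (Matrix.J (Fin n) ℝ * H) * Matrix.J (Fin n) ℝ) := by
    simp [Matrix.transpose_mul, hH, Matrix.J_transpose, Matrix.mul_assoc]
  simpa only [Matrix.smul_mul] using implicit_scheme_congruence hK hBC hBJ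
end

section
/- Let n ≥ 1, let J be the canonical 2n×2n symplectic matrix, let H be a symmetric real 2n×2n matrix, let h be a real number, and let B, C be real 2n×2n matrices satisfying B + C = I and B·J = J·Cᵀ. Then the matrix identity (I + h·J·H·B)·J·(I + h·J·H·B)ᵀ = (I − h·J·H·C)·J·(I − h·J·H·C)ᵀ holds. (Key identity in the proof of Proposition 1: the symplecticity condition A₁JA₁ᵀ − A₂JA₂ᵀ = 0 for the linearized implicit scheme.) -/
open Matrix

/-- Key identity in the proof of Proposition 1: under (i) `B + C = I` and
(ii) `B·J = J·Cᵀ`, one has `A₁·J·A₁ᵀ = A₂·J·A₂ᵀ` where `A₁ = I + h·J·H·B`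
and `A₂ = I − h·J·H·C`. -/
theorem stmt_1 (n : ℕ) (hn : 1 ≤ n)
    (H B C : Matrix (Fin n ⊕ Fin n) (Fin n ⊕ Fin n) ℝ)
    (hH : Hᵀ = H) (h : ℝ)
    (hBC : B + C = 1)
    (hBJ : B * Matrix.J (Fin n) ℝ = Matrix.J (Fin n) ℝ * Cᵀ) :
    (1 + h • (Matrix.J (Fin n) ℝ * H * B)) * Matrix.J (Fin n) ℝ *
        (1 + h • (Matrix.J (Fin n) ℝ * H * B))ᵀ =
      (1 - h • (Matrix.J (Fin n) ℝ * H * C)) * Matrix.J (Fin n) ℝ *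
        (1 - h • (Matrix.J (Fin n) ℝ * H * C))ᵀ := by
  have hJ : (Matrix.J (Fin n) ℝ)ᵀ = -Matrix.J (Fin n) ℝ := Matrix.J_transpose _ _
  generalize Matrix.J (Fin n) ℝ = K at *
  obtain rfl : C = 1 - B := eq_sub_of_add_eq' hBC
  have hKB : K * Bᵀ = K - B * K := by
    rw [hBJ, transpose_sub, transpose_one]
    noncomm_ring
  have mul_transpose_mul (X : Matrix (Fin n ⊕ Fin n) (Fin n ⊕ Fin n) ℝ) :
      K * (Bᵀ * X) = K * X - B * (K * X) := by
    rw [← mul_assoc, hKB, sub_mul, mul_assoc]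
  simp only [transpose_add, transpose_sub, transpose_smul, transpose_mul, transpose_one, hJ, hH,
    mul_add, add_mul, mul_sub, sub_mul, mul_one, one_mul, mul_neg, smul_mul_assoc,
    mul_smul_comm, mul_assoc, mul_transpose_mul, smul_sub, smul_neg, smul_add]
  abel
end
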